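/- arXiv:2402.17530 — 2 statements merged into one kernel-verified Lean document; each statement's English description precedes it below -/
import Mathlib

section
/- Let g be a positive definite symmetric real 3×3 matrix with inverse h, and let N ∈ ℝ³ be a g-unit vector. Then the operator P̄²_N on symmetric 3×3 matrices is idempotent: P̄²_N(P̄²_N(S)) = P̄²_N(S) for every symmetric S. Moreover, a symmetric 3×3 matrix A lies in the range of P̄²_N (i.e., there exists a symmetric S with P̄²_N(S) = A) if and only if A_{iN} = (tr A) N♭_i for every i, where A_{iN} := A_{ij} N^j. -/
open BigOperators

/-- `tr S := h^{ij} S_{ij}`. -/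
noncomputable def trH (h S : Fin 3 → Fin 3 → ℝ) : ℝ := ∑ i, ∑ j, h i j * S i j

/-- `S_{NN} := N^i N^j S_{ij}`. -/
noncomputable def quadN (N : Fin 3 → ℝ) (S : Fin 3 → Fin 3 → ℝ) : ℝ :=
  ∑ i, ∑ j, N i * N j * S i j

/-- `N♭_i := g_{ij} N^j`. -/
noncomputable def flat (g : Fin 3 → Fin 3 → ℝ) (N : Fin 3 → ℝ) : Fin 3 → ℝ :=
  fun i => ∑ j, g i j * N j

/-- The operator
`P̄²_N(S)_{ij} := S_{ij} + N♭_i (N♭_j tr S − S_{Nj}) + N♭_j (N♭_i tr S − S_{Ni})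
  − (1/2)(tr S − S_{NN}) g_{ij}`. -/
noncomputable def P2 (g h : Fin 3 → Fin 3 → ℝ) (N : Fin 3 → ℝ) (S : Fin 3 → Fin 3 → ℝ) :
    Fin 3 → Fin 3 → ℝ :=
  fun i j => S i j
    + flat g N i * (flat g N j * trH h S - ∑ k, N k * S k j)
    + flat g N j * (flat g N i * trH h S - ∑ k, N k * S k i)
    - (1 / 2) * (trH h S - quadN N S) * g i j

/-- The index-lowered vector is dual to `N` when `N` is `g`-unit. -/
lemma sum_flat_mul {g : Fin 3 → Fin 3 → ℝ} {N : Fin 3 → ℝ}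
    (hN : (∑ i, ∑ j, g i j * N i * N j) = 1) : ∑ j, flat g N j * N j = 1 := by
  rw [← hN]
  simp only [flat, Fin.sum_univ_three]
  ring

/-- Contracting the second index of the inverse metric with `N♭` gives `N`. -/
lemma sum_inv_mul_flat {g h : Fin 3 → Fin 3 → ℝ} (N : Fin 3 → ℝ)
    (h_inv : ∀ i j, (∑ k, h i k * g k j) = if i = j then (1 : ℝ) else 0) (i : Fin 3) :
    ∑ j, h i j * flat g N j = N i := by
  calc ∑ j, h i j * flat g N j = ∑ k, (∑ j, h i j * g j k) * N k := by
        simp only [flat, Fin.sum_univ_three]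
        ring
    _ = N i := by simp [h_inv]

/-- Contracting the first index of the inverse metric with `N♭` gives `N`. -/
lemma sum_inv_mul_flat' {g h : Fin 3 → Fin 3 → ℝ} (N : Fin 3 → ℝ)
    (hg : ∀ i j, g i j = g j i)
    (h_inv : ∀ i j, (∑ k, g i k * h k j) = if i = j then (1 : ℝ) else 0) (j : Fin 3) :
    ∑ i, h i j * flat g N i = N j := by
  calc ∑ i, h i j * flat g N i = ∑ k, (∑ i, g k i * h i j) * N k := by
        simp only [flat, Fin.sum_univ_three, hg 1 0, hg 2 0, hg 2 1]
        ring
    _ = N j := by simp [h_inv]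

lemma trH_metric {g h : Fin 3 → Fin 3 → ℝ} (hg : ∀ i j, g i j = g j i)
    (h_inv : ∀ i j, (∑ k, h i k * g k j) = if i = j then (1 : ℝ) else 0) :
    trH h g = 3 := by
  calc trH h g = ∑ i, ∑ k, h i k * g k i :=
        Finset.sum_congr rfl fun i _ => Finset.sum_congr rfl fun k _ => by rw [hg i k]
    _ = 3 := by simp [h_inv]

lemma P2_symm {g S : Fin 3 → Fin 3 → ℝ} (h : Fin 3 → Fin 3 → ℝ) (N : Fin 3 → ℝ)
    (hg : ∀ i j, g i j = g j i) (hS : ∀ i j, S i j = S j i) (i j : Fin 3) :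
    P2 g h N S i j = P2 g h N S j i := by
  simp only [P2, hS i j, hg i j]
  ring

lemma sum_P2_mul {g S : Fin 3 → Fin 3 → ℝ} (h : Fin 3 → Fin 3 → ℝ) {N : Fin 3 → ℝ}
    (hN : (∑ i, ∑ j, g i j * N i * N j) = 1) (hS : ∀ i j, S i j = S j i) (i : Fin 3) :
    ∑ j, P2 g h N S i j * N j = (3 / 2 * trH h S - 1 / 2 * quadN N S) * flat g N i := by
  have hn := sum_flat_mul hN
  have hgi : ∑ j, g i j * N j = flat g N i := rfl
  simp only [P2, quadN, Fin.sum_univ_three, hS _ i] at hn hgi ⊢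
  generalize trH h S = T
  generalize flat g N = n at hn hgi ⊢
  linear_combination (2 * n i * T - (N 0 * S i 0 + N 1 * S i 1 + N 2 * S i 2)) * hn
    - 1 / 2 * (T - (N 0 * N 0 * S 0 0 + N 0 * N 1 * S 0 1 + N 0 * N 2 * S 0 2
      + (N 1 * N 0 * S 1 0 + N 1 * N 1 * S 1 1 + N 1 * N 2 * S 1 2)
      + (N 2 * N 0 * S 2 0 + N 2 * N 1 * S 2 1 + N 2 * N 2 * S 2 2))) * hgi

lemma trH_P2 {g h S : Fin 3 → Fin 3 → ℝ} {N : Fin 3 → ℝ} (hg : ∀ i j, g i j = g j i)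
    (h_inv₁ : ∀ i j, (∑ k, g i k * h k j) = if i = j then (1 : ℝ) else 0)
    (h_inv₂ : ∀ i j, (∑ k, h i k * g k j) = if i = j then (1 : ℝ) else 0)
    (hN : (∑ i, ∑ j, g i j * N i * N j) = 1) :
    trH h (P2 g h N S) = 3 / 2 * trH h S - 1 / 2 * quadN N S := by
  have hn := sum_flat_mul hN
  have hl := sum_inv_mul_flat N h_inv₂
  have hr := sum_inv_mul_flat' N hg h_inv₁
  have ht := trH_metric hg h_inv₂
  have hq : quadN N S = ∑ j, (∑ k, N k * S k j) * N j := by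
    simp only [quadN, Fin.sum_univ_three]
    ring
  have expand : trH h (P2 g h N S) = trH h S
      + 2 * trH h S * (∑ j, (∑ i, h i j * flat g N i) * flat g N j)
      - (∑ j, (∑ i, h i j * flat g N i) * ∑ k, N k * S k j)
      - (∑ i, (∑ j, h i j * flat g N j) * ∑ k, N k * S k i)
      - 1 / 2 * (trH h S - quadN N S) * trH h g := by
    have hT : trH h S = ∑ i, ∑ j, h i j * S i j := rfl
    have hG : trH h g = ∑ i, ∑ j, h i j * g i j := rfl
    have hP : trH h (P2 g h N S) = ∑ i, ∑ j, h i j * P2 g h N S i j := rfl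
    rw [hP, hG]
    simp only [P2]
    generalize quadN N S = q, flat g N = n, trH h S = T at hT ⊢
    simp only [Fin.sum_univ_three] at hT ⊢
    linear_combination -hT
  have h1 : ∑ j, N j * flat g N j = 1 := by simpa only [mul_comm] using hn
  have h2 : ∑ j, N j * ∑ k, N k * S k j = quadN N S := by simpa only [mul_comm] using hq.symm
  simp only [expand, hl, hr, ht, h1, h2]
  ring

lemma P2_eq_self {g h A : Fin 3 → Fin 3 → ℝ} {N : Fin 3 → ℝ}
    (hN : (∑ i, ∑ j, g i j * N i * N j) = 1) (hA : ∀ i j, A i j = A j i)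
    (hAN : ∀ i, (∑ j, A i j * N j) = trH h A * flat g N i) : P2 g h N A = A := by
  have hv (j : Fin 3) : ∑ k, N k * A k j = trH h A * flat g N j := by
    rw [← hAN j]
    exact Finset.sum_congr rfl fun k _ => by rw [hA k j, mul_comm]
  have hq : quadN N A = trH h A := by
    calc quadN N A = ∑ i, N i * ∑ j, A i j * N j := by
          simp only [quadN, Fin.sum_univ_three]
          ring
      _ = trH h A * ∑ i, flat g N i * N i := by
          simp only [hAN, Fin.sum_univ_three]
          ring
      _ = trH h A := by rw [sum_flat_mul hN, mul_one]
  funext i j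
  simp only [P2, hv, hq]
  ring

/-- `P̄²_N` is idempotent on symmetric matrices, and a symmetric `A` lies in its
range iff `A_{iN} = (tr A) N♭_i` for every `i`. -/
theorem statement9
    (g h : Fin 3 → Fin 3 → ℝ)
    (hg_symm : ∀ i j, g i j = g j i)
    (hg_pos : ∀ ξ : Fin 3 → ℝ, ξ ≠ 0 → 0 < ∑ i, ∑ j, g i j * ξ i * ξ j)
    (h_inv₁ : ∀ i j, (∑ k, g i k * h k j) = if i = j then (1 : ℝ) else 0)
    (h_inv₂ : ∀ i j, (∑ k, h i k * g k j) = if i = j then (1 : ℝ) else 0)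
    (N : Fin 3 → ℝ)
    (hN : (∑ i, ∑ j, g i j * N i * N j) = 1) :
    (∀ S : Fin 3 → Fin 3 → ℝ, (∀ i j, S i j = S j i) →
        P2 g h N (P2 g h N S) = P2 g h N S)
    ∧ (∀ A : Fin 3 → Fin 3 → ℝ, (∀ i j, A i j = A j i) →
        ((∃ S : Fin 3 → Fin 3 → ℝ, (∀ i j, S i j = S j i) ∧ P2 g h N S = A)
          ↔ ∀ i, (∑ j, A i j * N j) = trH h A * flat g N i)) := by
  have hP (S : Fin 3 → Fin 3 → ℝ) (hS : ∀ i j, S i j = S j i) (i : Fin 3) :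
      ∑ j, P2 g h N S i j * N j = trH h (P2 g h N S) * flat g N i := by
    rw [sum_P2_mul h hN hS, trH_P2 hg_symm h_inv₁ h_inv₂ hN]
  refine ⟨fun S hS => P2_eq_self hN (P2_symm h N hg_symm hS) (hP S hS), fun A hA => ⟨?_, ?_⟩⟩
  · rintro ⟨S, hS, rfl⟩
    exact hP S hS
  · exact fun hAN => ⟨A, hA, P2_eq_self hN hA hAN⟩
end

section
/- Let U ⊆ ℝ³ be open; let g (positive definite symmetric 3×3, with pointwise inverse h), k₀ (symmetric 3×3), F̄ (symmetric 3×3), T (symmetric 3×3) and u (scalar, with ∇u ≠ 0 on U) be smooth fields on U. Set ω_i := ∂_i u, |∇u| := √(h^{ij} ω_i ω_j), N^i := h^{ij} ω_j / |∇u|, N♭_i := ω_i / |∇u|. Assume identically on U: (1) h^{ij} F̄_{ij} = 0 and F̄_{ij} h^{jk} ω_k = 0 for all i; (2) the projected geodesic identity: for every l, −N^m ∂_m N♭_l + (1/2) N^k N^a ∂_l g_{ka} + (∂_l |∇u|)/|∇u| = (N♭_l/|∇u|) N^m ∂_m |∇u|; (3) h^{ij} T_{ij} = −2 F̄_{ij}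 h^{ia} h^{jb} (k₀)_{ab}, and N^i T_{ij} = s^k F̄_{kj} for every j, where s^k := h^{kl}( −N^m ∂_m N♭_l − N^m (k₀)_{ml} + (1/2) N^a N^b ∂_l g_{ab} ). Define on U: D_l := h^{ij}( ∂_i g_{jl} − (1/2) ∂_l g_{ij} ); φ̂ := (1/(8|∇u|²)) F̄_{ij}( −h^{ia} ∂_a (h^{jb} ∂_b u) + |∇u| h^{ia} h^{jb}(k₀)_{ab} + (1/2) h^{lm} ∂_m u · ∂_l h^{ij} ); Q_l := −F̄_{lk} h^{ki}( D_i + N^m (k₀)_{mi} ) + h^{ij} ∂_i F̄_{lj} + (1/2) F̄_{ij} ∂_l h^{ij}, Q₀ := F̄_{ij} h^{ia} h^{jb} (k₀)_{ab}, Q_N := N^l Q_l, Q_L := |∇u|(Q₀ − Q_N); the covector G_i := (2φ̂ − Q_L/(2|∇u|²)) N♭_i + (Q_i − Q_N N♭_i)/|∇u|; the covector X̂_i := (1/2) h^{ba} ∂_a( |∇u| F̄_{bi} ) + (1/4) |∇u| F̄_{bc} ∂_i h^{bc} + (1/2) |∇u| ( ∂_a h^{ca} + (1/2) h^{ab} h^{cd}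 ∂_d g_{ab} ) F̄_{ic} − (1/2) ω_i F̄_{bc} h^{ba} h^{cd} (k₀)_{ad}; and the symmetric matrix κ_{ij} := −(N ⊗̃ X̂)_{ij}/|∇u| − (1/2) T_{ij} − (|∇u|/2)( 4 φ̂ g_{ij} − N♭_i G_j − N♭_j G_i ). Then identically on U: P̄²_N(κ)_{ij} + (N ⊗̃ X̂)_{ij}/|∇u| = −(1/2)( 4 |∇u| φ̂ g_{ij} − (ω_i G_j + ω_j G_i) + T_{ij} ) for all i, j; equivalently P̄²_N(κ) = κ. -/
open BigOperators

noncomputable section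

/-- The spatial slice `ℝ³`. -/
abbrev Spc : Type := Fin 3 → ℝ

/-- The partial derivative `∂_i f (x) := (fderiv ℝ f x)(e_i)`. -/
def pd (i : Fin 3) (f : Spc → ℝ) (x : Spc) : ℝ := fderiv ℝ f x (Pi.single i 1)

/-- `|∇u| := √(h^{ij} ∂_i u ∂_j u)`. -/
def nr (h : Fin 3 → Fin 3 → Spc → ℝ) (u : Spc → ℝ) (x : Spc) : ℝ :=
  Real.sqrt (∑ i, ∑ j, h i j x * pd i u x * pd j u x)

/-- `N^i := h^{ij} ∂_j u / |∇u|`. -/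
def Nup (h : Fin 3 → Fin 3 → Spc → ℝ) (u : Spc → ℝ) (i : Fin 3) (x : Spc) : ℝ :=
  (∑ j, h i j x * pd j u x) / nr h u x

/-- `N♭_i := ∂_i u / |∇u|`. -/
def Nlow (h : Fin 3 → Fin 3 → Spc → ℝ) (u : Spc → ℝ) (i : Fin 3) (x : Spc) : ℝ :=
  pd i u x / nr h u x

/-- The scalar `φ̂ = φ̂^{(2,1)}`. -/
def phiHat (h k₀ Fb : Fin 3 → Fin 3 → Spc → ℝ) (u : Spc → ℝ) (x : Spc) : ℝ :=
  (1 / (8 * (nr h u x) ^ 2)) *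
    ∑ i, ∑ j, Fb i j x *
      ( -(∑ a, h i a x * pd a (fun y => ∑ b, h j b y * pd b u y) x)
        + nr h u x * (∑ a, ∑ b, h i a x * h j b x * k₀ a b x)
        + (1 / 2) * (∑ l, ∑ m, h l m x * pd m u x * pd l (h i j) x) )

/-- The spatial wave-gauge covector `D_l := h^{ij}( ∂_i g_{jl} − (1/2) ∂_l g_{ij} )`. -/
def Dlow (g h : Fin 3 → Fin 3 → Spc → ℝ) (l : Fin 3) (x : Spc) : ℝ :=
  ∑ i, ∑ j, h i j x * (pd i (g j l) x - (1 / 2) * pd l (g i j) x)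

/-- The spatial components `Q_l` of the covector `Q = Q^{(0)}`, with data `D`. -/
def Qc (h k₀ Fb : Fin 3 → Fin 3 → Spc → ℝ) (u : Spc → ℝ) (D : Fin 3 → Spc → ℝ)
    (l : Fin 3) (x : Spc) : ℝ :=
  -(∑ k, ∑ i, Fb l k x * h k i x * (D i x + ∑ m, Nup h u m x * k₀ m i x))
  + (∑ i, ∑ j, h i j x * pd i (Fb l j) x)
  + (1 / 2) * (∑ i, ∑ j, Fb i j x * pd l (h i j) x)

/-- The time component `Q₀ := F̄_{ij} h^{ia} h^{jb} (k₀)_{ab}`. -/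
def Q0 (h k₀ Fb : Fin 3 → Fin 3 → Spc → ℝ) (x : Spc) : ℝ :=
  ∑ i, ∑ j, ∑ a, ∑ b, Fb i j x * h i a x * h j b x * k₀ a b x

/-- `Q_N := N^l Q_l`. -/
def QN (h k₀ Fb : Fin 3 → Fin 3 → Spc → ℝ) (u : Spc → ℝ) (D : Fin 3 → Spc → ℝ)
    (x : Spc) : ℝ :=
  ∑ l, Nup h u l x * Qc h k₀ Fb u D l x

/-- `Q_L := |∇u| (Q₀ − Q_N)`. -/
def QL (h k₀ Fb : Fin 3 → Fin 3 → Spc → ℝ) (u : Spc → ℝ) (D : Fin 3 → Spc → ℝ)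
    (x : Spc) : ℝ :=
  nr h u x * (Q0 h k₀ Fb x - QN h k₀ Fb u D x)

/-- The covector `G_i = F^{(2,1)}_{0i}`. -/
def Gc (g h k₀ Fb : Fin 3 → Fin 3 → Spc → ℝ) (u : Spc → ℝ) (i : Fin 3) (x : Spc) : ℝ :=
  (2 * phiHat h k₀ Fb u x - QL h k₀ Fb u (Dlow g h) x / (2 * (nr h u x) ^ 2))
      * Nlow h u i x
  + (Qc h k₀ Fb u (Dlow g h) i x - QN h k₀ Fb u (Dlow g h) x * Nlow h u i x) / nr h u x

/-- The covector `X̂ = X̂^{(2,1)}`. -/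
def Xhat (g h k₀ Fb : Fin 3 → Fin 3 → Spc → ℝ) (u : Spc → ℝ) (i : Fin 3) (x : Spc) : ℝ :=
  (1 / 2) * (∑ b, ∑ a, h b a x * pd a (fun y => nr h u y * Fb b i y) x)
  + (1 / 4) * nr h u x * (∑ b, ∑ c, Fb b c x * pd i (h b c) x)
  + (1 / 2) * nr h u x *
      (∑ c, ((∑ a, pd a (h c a) x)
          + (1 / 2) * ∑ a, ∑ b, ∑ d, h a b x * h c d x * pd d (g a b) x) * Fb i c x)
  - (1 / 2) * pd i u x * (∑ b, ∑ c, ∑ a, ∑ d, Fb b c x * h b a x * h c d x * k₀ a d x)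

/-- `(N ⊗̃ X)_{ij} := N♭_i X_j + N♭_j X_i − (1/2)(N^k X_k) g_{ij}` with `N♭_i = g_{ik} N^k`. -/
def tensf (g : Fin 3 → Fin 3 → Spc → ℝ) (N X : Fin 3 → Spc → ℝ) (i j : Fin 3)
    (x : Spc) : ℝ :=
  (∑ k, g i k x * N k x) * X j x + (∑ k, g j k x * N k x) * X i x
    - (1 / 2) * (∑ k, N k x * X k x) * g i j x

/-- The operator `P̄²_N` applied pointwise to a field `S`. -/
def P2f (g h : Fin 3 → Fin 3 → Spc → ℝ) (N : Fin 3 → Spc → ℝ)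
    (S : Fin 3 → Fin 3 → Spc → ℝ) (i j : Fin 3) (x : Spc) : ℝ :=
  S i j x
  + (∑ k, g i k x * N k x) *
      ((∑ k, g j k x * N k x) * (∑ a, ∑ b, h a b x * S a b x) - (∑ a, N a x * S a j x))
  + (∑ k, g j k x * N k x) *
      ((∑ k, g i k x * N k x) * (∑ a, ∑ b, h a b x * S a b x) - (∑ a, N a x * S a i x))
  - (1 / 2) * ((∑ a, ∑ b, h a b x * S a b x) - (∑ a, ∑ b, N a x * N b x * S a b x))
      * g i j x

/-- The vector `s^k` appearing in hypothesis (3). -/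
def sVec (g h k₀ : Fin 3 → Fin 3 → Spc → ℝ) (u : Spc → ℝ) (k : Fin 3) (x : Spc) : ℝ :=
  ∑ l, h k l x *
    ( -(∑ m, Nup h u m x * pd m (Nlow h u l) x)
      - (∑ m, Nup h u m x * k₀ m l x)
      + (1 / 2) * ∑ a, ∑ b, Nup h u a x * Nup h u b x * pd l (g a b) x )

/-- The tensor `κ = κ^{(1,1)}`. -/
def kap17 (g h k₀ Fb T : Fin 3 → Fin 3 → Spc → ℝ) (u : Spc → ℝ) (i j : Fin 3)
    (x : Spc) : ℝ :=
  -(tensf g (Nup h u) (Xhat g h k₀ Fb u) i j x) / nr h u x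
  - (1 / 2) * T i j x
  - (nr h u x / 2) *
      (4 * phiHat h k₀ Fb u x * g i j x
        - Nlow h u i x * Gc g h k₀ Fb u j x - Nlow h u j x * Gc g h k₀ Fb u i x)

end

section PartialDerivatives

lemma pd_congr_of_eqOn {U : Set Spc} (hU : IsOpen U) {f₁ f₂ : Spc → ℝ}
    (hf : ∀ x ∈ U, f₁ x = f₂ x) {x : Spc} (hx : x ∈ U) (a : Fin 3) :
    pd a f₁ x = pd a f₂ x := by
  have : f₁ =ᶠ[nhds x] f₂ := Filter.eventually_of_mem (hU.mem_nhds hx) hf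
  rw [pd, pd, this.fderiv_eq]

lemma pd_mul {f₁ f₂ : Spc → ℝ} {x : Spc} (h₁ : DifferentiableAt ℝ f₁ x)
    (h₂ : DifferentiableAt ℝ f₂ x) (a : Fin 3) :
    pd a (fun y => f₁ y * f₂ y) x = pd a f₁ x * f₂ x + f₁ x * pd a f₂ x := by
  simp only [pd, fderiv_fun_mul h₁ h₂, add_apply,
    smul_apply, smul_eq_mul]
  ring

lemma pd_sum_mul {f₁ f₂ : Fin 3 → Spc → ℝ} {x : Spc}
    (h₁ : ∀ k, DifferentiableAt ℝ (f₁ k) x) (h₂ : ∀ k, DifferentiableAt ℝ (f₂ k) x)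
    (a : Fin 3) :
    pd a (fun y => ∑ k, f₁ k y * f₂ k y) x
      = ∑ k, (pd a (f₁ k) x * f₂ k x + f₁ k x * pd a (f₂ k) x) := by
  simp_rw [← fun k => pd_mul (h₁ k) (h₂ k) a]
  simp only [pd]
  rw [fderiv_fun_sum (fun k _ => (h₁ k).fun_mul (h₂ k)), sum_apply]

lemma pd_const (c : ℝ) (x : Spc) (a : Fin 3) : pd a (fun _ => c) x = 0 := by
  simp [pd]

lemma ContDiffOn.differentiableAt_pd {U : Set Spc} (hU : IsOpen U) {u : Spc → ℝ}
    (hu : ContDiffOn ℝ (⊤ : ℕ∞) u U) {x : Spc} (hx : x ∈ U) (a : Fin 3) :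
    DifferentiableAt ℝ (pd a u) x := by
  have h₁ : ContDiffOn ℝ 1 (fderiv ℝ u) U :=
    hu.fderiv_of_isOpen hU (WithTop.coe_le_coe.2 le_top)
  exact ((h₁.differentiableOn one_ne_zero).differentiableAt (hU.mem_nhds hx)).clm_apply
    (differentiableAt_const _)

end PartialDerivatives

section PointwiseAlgebra

variable {g h : Fin 3 → Fin 3 → ℝ}

lemma inverse_symm (hg : ∀ i j, g i j = g j i)
    (h₁ : ∀ i j, ∑ k, g i k * h k j = if i = j then 1 else 0)
    (h₂ : ∀ i j, ∑ k, h i k * g k j = if i = j then 1 else 0) (i j : Fin 3) :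
    h i j = h j i := by
  have m₁ : Matrix.of g * Matrix.of h = 1 := by
    ext i j; simp [Matrix.mul_apply, h₁, Matrix.one_apply]
  have m₂ : (Matrix.of h) * Matrix.of g = 1 := by
    ext i j; simp [Matrix.mul_apply, h₂, Matrix.one_apply]
  have mg : (Matrix.of g).transpose = Matrix.of g := by
    ext i j; simp [hg i j]
  have m₃ : Matrix.of g * (Matrix.of h).transpose = 1 := by
    rw [← mg, ← Matrix.transpose_mul, m₂, Matrix.transpose_one]
  have m₄ : Matrix.of h = (Matrix.of h).transpose :=
    left_inv_eq_right_inv m₂ m₃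
  exact congrFun (congrFun m₄ i) j

lemma lower_raise (h₁ : ∀ i j, ∑ k, g i k * h k j = if i = j then 1 else 0)
    (w : Fin 3 → ℝ) (i : Fin 3) : ∑ k, g i k * ∑ j, h k j * w j = w i := by
  simp_rw [Finset.mul_sum, ← mul_assoc]
  rw [Finset.sum_comm]
  simp_rw [← Finset.sum_mul, h₁]
  simp

lemma inverse_quadratic_pos (hg : ∀ ξ : Fin 3 → ℝ, ξ ≠ 0 → 0 < ∑ i, ∑ j, g i j * ξ i * ξ j)
    (h₁ : ∀ i j, ∑ k, g i k * h k j = if i = j then 1 else 0)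
    {w : Fin 3 → ℝ} (hw : w ≠ 0) : 0 < ∑ i, ∑ j, h i j * w i * w j := by
  have key := lower_raise h₁ w
  have hne : (fun k => ∑ j, h k j * w j) ≠ 0 := by
    intro h0
    apply hw
    ext i
    rw [← key i]
    simp [fun k => congrFun h0 k]
  refine (hg _ hne).trans_eq ?_
  refine Finset.sum_congr rfl fun i _ => ?_
  have : ∀ j, g i j * (∑ l, h i l * w l) * (∑ l, h j l * w l)
      = (∑ l, h i l * w l) * (g i j * ∑ l, h j l * w l) := fun j => by ring
  simp_rw [this]
  rw [← Finset.mul_sum, key i, Finset.sum_mul]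
  exact Finset.sum_congr rfl fun j _ => by ring

variable {N Nl : Fin 3 → ℝ}

/-- The `h`-trace of `Nl ⊗ Y + Y ⊗ Nl + q g + r T`. -/
lemma trace_decomposition (hh : ∀ i j, h i j = h j i)
    (h₁ : ∀ i j, ∑ k, g i k * h k j = if i = j then 1 else 0)
    (hg : ∀ i j, g i j = g j i)
    (hN : ∀ i, ∑ j, h i j * Nl j = N i) (Y : Fin 3 → ℝ) (q r : ℝ) (T : Fin 3 → Fin 3 → ℝ) :
    ∑ a, ∑ b, h a b * (Nl a * Y b + Nl b * Y a + q * g a b + r * T a b)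
      = 2 * (∑ k, N k * Y k) + 3 * q + r * ∑ a, ∑ b, h a b * T a b := by
  have e₀ := h₁ 0 0
  have e₁ := h₁ 1 1
  have e₂ := h₁ 2 2
  simp only [← hN, Fin.sum_univ_three, if_true] at *
  rw [hh 1 0, hh 2 0, hh 2 1, hg 1 0, hg 2 0, hg 2 1] at *
  linear_combination q * (e₀ + e₁ + e₂)

/-- The contraction with `N` of `Nl ⊗ Y + Y ⊗ Nl + q g + r T`. -/
lemma contraction_decomposition (hg : ∀ i j, g i j = g j i)
    (hgN : ∀ i, ∑ k, g i k * N k = Nl i) (hNN : ∑ k, N k * Nl k = 1)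
    (Y : Fin 3 → ℝ) (q r : ℝ) (T : Fin 3 → Fin 3 → ℝ) (j : Fin 3) :
    ∑ a, N a * (Nl a * Y j + Nl j * Y a + q * g a j + r * T a j)
      = Y j + Nl j * (∑ k, N k * Y k) + q * Nl j + r * ∑ a, N a * T a j := by
  have e := hgN j
  simp only [hg j] at e
  simp only [Fin.sum_univ_three] at *
  linear_combination Y j * hNN + q * e

end PointwiseAlgebra

/-- `P̄²_N` fixes every tensor whose contraction with `N` is its trace times `N♭`. -/
lemma P2f_eq_self {g h : Fin 3 → Fin 3 → Spc → ℝ} {N : Fin 3 → Spc → ℝ} {x : Spc}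
    {S : Fin 3 → Fin 3 → Spc → ℝ} (hNN : ∑ i, N i x * ∑ k, g i k x * N k x = 1)
    (hS : ∀ j, ∑ a, N a x * S a j x
      = (∑ a, ∑ b, h a b x * S a b x) * ∑ k, g j k x * N k x) (i j : Fin 3) :
    P2f g h N S i j x = S i j x := by
  have hSN : ∑ a, ∑ b, N a x * N b x * S a b x = ∑ a, ∑ b, h a b x * S a b x := by
    rw [Finset.sum_comm]
    have : ∀ b, ∑ a, N a x * N b x * S a b x = N b x * ∑ a, N a x * S a b x := fun b => by
      rw [Finset.mul_sum]
      exact Finset.sum_congr rfl fun a _ => by ring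
    simp_rw [this, hS, mul_left_comm (N _ x) (∑ a, ∑ b, h a b x * S a b x)]
    rw [← Finset.mul_sum, hNN, mul_one]
  rw [P2f, hSN, hS, hS]
  ring

section Metric

variable {U : Set Spc} {g h : Fin 3 → Fin 3 → Spc → ℝ}

lemma pd_inverse (hU : IsOpen U)
    (hg : ∀ i j, ContDiffOn ℝ (⊤ : ℕ∞) (g i j) U)
    (hh : ∀ i j, ContDiffOn ℝ (⊤ : ℕ∞) (h i j) U)
    (h₁ : ∀ x ∈ U, ∀ i j, (∑ k, g i k x * h k j x) = if i = j then (1 : ℝ) else 0)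
    (h₂ : ∀ x ∈ U, ∀ i j, (∑ k, h i k x * g k j x) = if i = j then (1 : ℝ) else 0)
    {x : Spc} (hx : x ∈ U) (a c d : Fin 3) :
    pd a (h c d) x = -∑ p, ∑ q, h c p x * h q d x * pd a (g p q) x := by
  have dg : ∀ i j, DifferentiableAt ℝ (g i j) x := fun i j =>
    ((hg i j).differentiableOn (by simp)).differentiableAt (hU.mem_nhds hx)
  have dh : ∀ i j, DifferentiableAt ℝ (h i j) x := fun i j =>
    ((hh i j).differentiableOn (by simp)).differentiableAt (hU.mem_nhds hx)
  have e : ∀ q, ∑ k, pd a (h c k) x * g k q x = -∑ k, h c k x * pd a (g k q) x := by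
    intro q
    have := pd_congr_of_eqOn hU (fun y hy => h₂ y hy c q) hx a
    rw [pd_const, pd_sum_mul (fun k => dh c k) (fun k => dg k q), Finset.sum_add_distrib] at this
    linarith
  have e' : ∑ q, (∑ k, pd a (h c k) x * g k q x) * h q d x = pd a (h c d) x := by
    simp_rw [Finset.sum_mul, mul_assoc]
    rw [Finset.sum_comm]
    simp_rw [← Finset.mul_sum, h₁ x hx]
    simp
  rw [← e']
  simp_rw [e]
  rw [Finset.sum_comm]
  simp only [neg_mul, Finset.sum_mul, Finset.sum_neg_distrib]
  congr 1
  exact Finset.sum_congr rfl fun q _ => Finset.sum_congr rfl fun p _ => by ring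

/-- The contracted Christoffel symbol of the inverse metric is minus the raised `Dlow`. -/
lemma contracted_pd_inverse (hU : IsOpen U)
    (hg : ∀ i j, ContDiffOn ℝ (⊤ : ℕ∞) (g i j) U)
    (hh : ∀ i j, ContDiffOn ℝ (⊤ : ℕ∞) (h i j) U)
    (hg_symm : ∀ x ∈ U, ∀ i j, g i j x = g j i x)
    (h₁ : ∀ x ∈ U, ∀ i j, (∑ k, g i k x * h k j x) = if i = j then (1 : ℝ) else 0)
    (h₂ : ∀ x ∈ U, ∀ i j, (∑ k, h i k x * g k j x) = if i = j then (1 : ℝ) else 0)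
    {x : Spc} (hx : x ∈ U) (c : Fin 3) :
    (∑ a, pd a (h c a) x)
        + (1 / 2) * ∑ a, ∑ b, ∑ d, h a b x * h c d x * pd d (g a b) x
      = -∑ d, h c d x * Dlow g h d x := by
  have hs := inverse_symm (hg_symm x hx) (h₁ x hx) (h₂ x hx)
  have gs : ∀ a p q, pd a (g p q) x = pd a (g q p) x := fun a p q =>
    pd_congr_of_eqOn hU (fun y hy => hg_symm y hy p q) hx a
  simp_rw [pd_inverse hU hg hh h₁ h₂ hx, Dlow]
  simp only [Fin.sum_univ_three]
  simp only [hs 1 0, hs 2 0, hs 2 1, gs _ 1 0, gs _ 2 0, gs _ 2 1]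
  ring

end Metric

/-- the initial-data matching identity for the first-harmonic part of the
second fundamental form: `P̄²_N(κ) + (N ⊗̃ X̂)/|∇u| = −(1/2)(4|∇u|φ̂ g − (ω ⊗ G)_{sym} + T)`,
equivalently `P̄²_N(κ) = κ`, identically on `U`. -/
theorem statement17
    (U : Set Spc) (hU : IsOpen U)
    (g h k₀ Fb T : Fin 3 → Fin 3 → Spc → ℝ) (u : Spc → ℝ)
    (hg_smooth : ∀ i j, ContDiffOn ℝ (⊤ : ℕ∞) (g i j) U)
    (hh_smooth : ∀ i j, ContDiffOn ℝ (⊤ : ℕ∞) (h i j) U)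
    (hk_smooth : ∀ i j, ContDiffOn ℝ (⊤ : ℕ∞) (k₀ i j) U)
    (hF_smooth : ∀ i j, ContDiffOn ℝ (⊤ : ℕ∞) (Fb i j) U)
    (hT_smooth : ∀ i j, ContDiffOn ℝ (⊤ : ℕ∞) (T i j) U)
    (hu_smooth : ContDiffOn ℝ (⊤ : ℕ∞) u U)
    (hg_symm : ∀ x ∈ U, ∀ i j, g i j x = g j i x)
    (hg_pos : ∀ x ∈ U, ∀ ξ : Fin 3 → ℝ, ξ ≠ 0 → 0 < ∑ i, ∑ j, g i j x * ξ i * ξ j)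
    (hk_symm : ∀ x ∈ U, ∀ i j, k₀ i j x = k₀ j i x)
    (hF_symm : ∀ x ∈ U, ∀ i j, Fb i j x = Fb j i x)
    (hT_symm : ∀ x ∈ U, ∀ i j, T i j x = T j i x)
    (h_inv₁ : ∀ x ∈ U, ∀ i j, (∑ k, g i k x * h k j x) = if i = j then (1 : ℝ) else 0)
    (h_inv₂ : ∀ x ∈ U, ∀ i j, (∑ k, h i k x * g k j x) = if i = j then (1 : ℝ) else 0)
    (hgrad : ∀ x ∈ U, (fun i => pd i u x) ≠ 0)
    -- hypothesis (1): F̄ is g-trace-free and transverse to ∇u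
    (hF_tr : ∀ x ∈ U, (∑ i, ∑ j, h i j x * Fb i j x) = 0)
    (hF_trans : ∀ x ∈ U, ∀ i, (∑ j, ∑ k, Fb i j x * h j k x * pd k u x) = 0)
    -- hypothesis (2): the projected geodesic identity
    (hgeo : ∀ x ∈ U, ∀ l,
      -(∑ m, Nup h u m x * pd m (Nlow h u l) x)
        + (1 / 2) * (∑ k, ∑ a, Nup h u k x * Nup h u a x * pd l (g k a) x)
        + pd l (nr h u) x / nr h u x
      = (Nlow h u l x / nr h u x) * (∑ m, Nup h u m x * pd m (nr h u) x))
    -- hypothesis (3): the contractions of T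
    (hT_tr : ∀ x ∈ U,
      (∑ i, ∑ j, h i j x * T i j x)
        = -2 * ∑ i, ∑ j, ∑ a, ∑ b, Fb i j x * h i a x * h j b x * k₀ a b x)
    (hT_N : ∀ x ∈ U, ∀ j,
      (∑ i, Nup h u i x * T i j x) = ∑ k, sVec g h k₀ u k x * Fb k j x) :
    ∀ x ∈ U,
      (∀ i j,
        P2f g h (Nup h u) (kap17 g h k₀ Fb T u) i j x
          + tensf g (Nup h u) (Xhat g h k₀ Fb u) i j x / nr h u x
        = -(1 / 2) *
            (4 * nr h u x * phiHat h k₀ Fb u x * g i j x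
              - (pd i u x * Gc g h k₀ Fb u j x + pd j u x * Gc g h k₀ Fb u i x)
              + T i j x))
      ∧ (∀ i j,
        P2f g h (Nup h u) (kap17 g h k₀ Fb T u) i j x = kap17 g h k₀ Fb T u i j x) := by
  intro x hx
  have hs := inverse_symm (hg_symm x hx) (h_inv₁ x hx) (h_inv₂ x hx)
  have diff : ∀ {f : Spc → ℝ}, ContDiffOn ℝ (⊤ : ℕ∞) f U → DifferentiableAt ℝ f x :=
    fun hf => (hf.differentiableOn (by simp)).differentiableAt (hU.mem_nhds hx)
  have dF := fun i j => diff (hF_smooth i j)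
  have dh := fun i j => diff (hh_smooth i j)
  have du := fun i => ContDiffOn.differentiableAt_pd hU hu_smooth hx i
  have qpos : 0 < ∑ i, ∑ j, h i j x * pd i u x * pd j u x :=
    inverse_quadratic_pos (hg_pos x hx) (h_inv₁ x hx) (hgrad x hx)
  have npos : 0 < nr h u x := Real.sqrt_pos.2 qpos
  have nsq : nr h u x ^ 2 = ∑ i, ∑ j, h i j x * pd i u x * pd j u x := Real.sq_sqrt qpos.le
  have dn : DifferentiableAt ℝ (nr h u) x :=
    (DifferentiableAt.fun_sum fun i _ => DifferentiableAt.fun_sum fun j _ =>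
      ((dh i j).mul (du i)).mul (du j)).sqrt qpos.ne'
  have hω : ∀ i, pd i u x = nr h u x * Nlow h u i x := fun i => by
    rw [Nlow, mul_div_cancel₀ _ npos.ne']
  have hW : ∀ i, ∑ j, h i j x * pd j u x = nr h u x * Nup h u i x := fun i => by
    rw [Nup, mul_div_cancel₀ _ npos.ne']
  have hN : ∀ i, ∑ j, h i j x * Nlow h u j x = Nup h u i x := fun i => by
    simp_rw [Nup, Nlow, Finset.sum_div, mul_div_assoc]
  have hgN : ∀ i, ∑ k, g i k x * Nup h u k x = Nlow h u i x := fun i => by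
    simp_rw [← hN]
    exact lower_raise (h_inv₁ x hx) (fun j => Nlow h u j x) i
  have hNN : ∑ k, Nup h u k x * Nlow h u k x = 1 := by
    have e : nr h u x ^ 2 * ∑ k, Nup h u k x * Nlow h u k x = nr h u x ^ 2 * 1 := by
      rw [mul_one]
      conv_rhs => rw [nsq]
      rw [Finset.mul_sum]
      refine Finset.sum_congr rfl fun k _ => ?_
      have : ∑ j, h k j x * pd k u x * pd j u x = pd k u x * ∑ j, h k j x * pd j u x := by
        rw [Finset.mul_sum]
        exact Finset.sum_congr rfl fun j _ => by ring
      rw [this, hW, hω]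
      ring
    exact mul_left_cancel₀ (pow_ne_zero 2 npos.ne') e
  have hFW : ∀ y ∈ U, ∀ i, ∑ j, Fb i j y * ∑ k, h j k y * pd k u y = 0 := fun y hy i => by
    rw [← hF_trans y hy i]
    simp_rw [Finset.mul_sum, mul_assoc]
  have hFN : ∀ i, ∑ j, Fb i j x * Nup h u j x = 0 := fun i => by
    have e := hFW x hx i
    simp_rw [hW, mul_left_comm _ (nr h u x)] at e
    rw [← Finset.mul_sum] at e
    exact (mul_eq_zero.1 e).resolve_left npos.ne'
  have hdFW : ∀ a i, ∑ j, Fb i j x * pd a (fun y => ∑ b, h j b y * pd b u y) x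
      = -(nr h u x * ∑ j, pd a (Fb i j) x * Nup h u j x) := fun a i => by
    have e := pd_congr_of_eqOn hU (fun y hy => hFW y hy i) hx a
    rw [pd_const, pd_sum_mul (fun j => dF i j)
      (fun j => DifferentiableAt.fun_sum fun b _ => (dh j b).fun_mul (du b)),
      Finset.sum_add_distrib] at e
    simp_rw [hW, mul_left_comm _ (nr h u x)] at e
    rw [← Finset.mul_sum] at e
    linarith
  have hFs : ∀ a i j, pd a (Fb i j) x = pd a (Fb j i) x := fun a i j =>
    pd_congr_of_eqOn hU (fun y hy => hF_symm y hy i j) hx a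
  have hX : ∀ j, Xhat g h k₀ Fb u j x / nr h u x
      = (1 / 2) * Qc h k₀ Fb u (Dlow g h) j x
        + (1 / 2) * (∑ k, ∑ i, Fb j k x * h k i x * ∑ m, Nup h u m x * k₀ m i x)
        + (1 / 2) * (∑ b, ∑ a, h b a x * pd a (nr h u) x * Fb b j x) / nr h u x
        - (1 / 2) * Nlow h u j x * Q0 h k₀ Fb x := by
    intro j
    rw [div_eq_iff npos.ne']
    have e : ∑ b, ∑ a, h b a x * pd a (fun y => nr h u y * Fb b j y) x
        = (∑ b, ∑ a, h b a x * pd a (nr h u) x * Fb b j x)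
          + nr h u x * ∑ b, ∑ a, h b a x * pd b (Fb j a) x := by
      simp_rw [fun a b => pd_mul dn (dF b j) a]
      simp only [Fin.sum_univ_three, hFs _ _ j, hs 1 0, hs 2 0, hs 2 1]
      ring
    have e' : ∑ k, ∑ i, Fb j k x * h k i x * (Dlow g h i x + ∑ m, Nup h u m x * k₀ m i x)
        = (∑ k, Fb j k x * ∑ i, h k i x * Dlow g h i x)
          + ∑ k, ∑ i, Fb j k x * h k i x * ∑ m, Nup h u m x * k₀ m i x := by
      simp_rw [mul_add, Finset.sum_add_distrib, Finset.mul_sum, mul_assoc]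
    have e'' : ∑ c, (-∑ d, h c d x * Dlow g h d x) * Fb j c x
        = -∑ k, Fb j k x * ∑ i, h k i x * Dlow g h i x := by
      rw [← Finset.sum_neg_distrib]
      exact Finset.sum_congr rfl fun c _ => by ring
    rw [Xhat, Qc, e, e', hω]
    simp_rw [contracted_pd_inverse hU hg_smooth hh_smooth hg_symm h_inv₁ h_inv₂ hx]
    rw [e'', Q0]
    field_simp
    ring
  have hTN : ∀ j, ∑ i, Nup h u i x * T i j x
      = -(∑ k, ∑ i, Fb j k x * h k i x * ∑ m, Nup h u m x * k₀ m i x)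
        - (∑ b, ∑ a, h b a x * pd a (nr h u) x * Fb b j x) / nr h u x := by
    intro j
    set c := (∑ m, Nup h u m x * pd m (nr h u) x) / nr h u x with hc
    have e : ∀ k, sVec g h k₀ u k x
        = c * Nup h u k x - (∑ l, h k l x * pd l (nr h u) x) / nr h u x
          - ∑ l, h k l x * ∑ m, Nup h u m x * k₀ m l x := by
      intro k
      rw [sVec, ← hN k, Finset.mul_sum, Finset.sum_div, ← Finset.sum_sub_distrib,
        ← Finset.sum_sub_distrib]
      refine Finset.sum_congr rfl fun l _ => ?_
      linear_combination h k l x * hgeo x hx l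
    rw [hT_N x hx j]
    have e₀ := hFN j
    simp_rw [e]
    have e₁ : ∀ k, (c * Nup h u k x - (∑ l, h k l x * pd l (nr h u) x) / nr h u x
          - ∑ l, h k l x * ∑ m, Nup h u m x * k₀ m l x) * Fb k j x
        = c * (Fb j k x * Nup h u k x)
          - (∑ l, h k l x * pd l (nr h u) x * Fb k j x) / nr h u x
          - ∑ l, Fb j k x * h k l x * ∑ m, Nup h u m x * k₀ m l x := fun k => by
      simp_rw [mul_assoc (Fb j k x)]
      rw [← Finset.sum_mul, ← Finset.mul_sum, hF_symm x hx j k]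
      ring
    simp_rw [e₁, Finset.sum_sub_distrib]
    rw [← Finset.mul_sum, e₀, Finset.sum_div]
    ring
  have hQN : QN h k₀ Fb u (Dlow g h) x
      = (∑ i, ∑ a, h i a x * ∑ j, pd a (Fb i j) x * Nup h u j x)
        + (1 / 2) * ∑ i, ∑ j, Fb i j x * ∑ l, Nup h u l x * pd l (h i j) x := by
    have e₀ : ∑ l, Nup h u l x * ∑ k, ∑ i, Fb l k x * h k i x
        * (Dlow g h i x + ∑ m, Nup h u m x * k₀ m i x) = 0 := by
      simp_rw [Finset.mul_sum]
      rw [Finset.sum_comm]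
      refine Finset.sum_eq_zero fun k _ => ?_
      rw [Finset.sum_comm]
      refine Finset.sum_eq_zero fun i _ => ?_
      have : ∀ l, Nup h u l x * (Fb l k x * h k i x
            * (Dlow g h i x + ∑ m, Nup h u m x * k₀ m i x))
          = Fb k l x * Nup h u l x
            * (h k i x * (Dlow g h i x + ∑ m, Nup h u m x * k₀ m i x)) := fun l => by
        rw [hF_symm x hx l k]
        ring
      simp_rw [this]
      rw [← Finset.sum_mul, hFN, zero_mul]
    have e₁ : QN h k₀ Fb u (Dlow g h) x
        = -(∑ l, Nup h u l x * ∑ k, ∑ i, Fb l k x * h k i x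
            * (Dlow g h i x + ∑ m, Nup h u m x * k₀ m i x))
          + (∑ l, Nup h u l x * ∑ i, ∑ j, h i j x * pd i (Fb l j) x)
          + (1 / 2) * ∑ l, Nup h u l x * ∑ i, ∑ j, Fb i j x * pd l (h i j) x := by
      rw [QN, Finset.mul_sum, ← Finset.sum_neg_distrib, ← Finset.sum_add_distrib,
        ← Finset.sum_add_distrib]
      refine Finset.sum_congr rfl fun l _ => ?_
      rw [Qc]
      ring
    rw [e₁, e₀]
    simp only [Fin.sum_univ_three, hs 1 0, hs 2 0, hs 2 1, hFs _ 1 0, hFs _ 2 0, hFs _ 2 1]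
    ring
  have hφ : 8 * nr h u x * phiHat h k₀ Fb u x
      = Q0 h k₀ Fb x + QN h k₀ Fb u (Dlow g h) x := by
    have e₀ : ∑ i, ∑ j, Fb i j x * ∑ a, h i a x * pd a (fun y => ∑ b, h j b y * pd b u y) x
        = -(nr h u x * ∑ i, ∑ a, h i a x * ∑ j, pd a (Fb i j) x * Nup h u j x) := by
      rw [Finset.mul_sum, ← Finset.sum_neg_distrib]
      refine Finset.sum_congr rfl fun i _ => ?_
      have e : ∀ j, Fb i j x * ∑ a, h i a x * pd a (fun y => ∑ b, h j b y * pd b u y) x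
          = ∑ a, h i a x * (Fb i j x * pd a (fun y => ∑ b, h j b y * pd b u y) x) := fun j => by
        rw [Finset.mul_sum]
        exact Finset.sum_congr rfl fun a _ => by ring
      rw [Finset.sum_congr rfl fun j _ => e j, Finset.sum_comm, Finset.mul_sum, ← Finset.sum_neg_distrib]
      refine Finset.sum_congr rfl fun a _ => ?_
      rw [← Finset.mul_sum, hdFW]
      ring
    have e₁ : Q0 h k₀ Fb x
        = ∑ i, ∑ j, Fb i j x * ∑ a, ∑ b, h i a x * h j b x * k₀ a b x := by
      simp_rw [Q0, Finset.mul_sum, mul_assoc]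
    have e₂ : ∀ i j, ∑ l, ∑ m, h l m x * pd m u x * pd l (h i j) x
        = nr h u x * ∑ l, Nup h u l x * pd l (h i j) x := fun i j => by
      simp_rw [← Finset.sum_mul, hW]
      rw [Finset.mul_sum]
      exact Finset.sum_congr rfl fun l _ => by ring
    have e₃ : 8 * nr h u x ^ 2 * phiHat h k₀ Fb u x
        = -(∑ i, ∑ j, Fb i j x
            * ∑ a, h i a x * pd a (fun y => ∑ b, h j b y * pd b u y) x)
          + nr h u x * Q0 h k₀ Fb x
          + (1 / 2) * nr h u x
            * ∑ i, ∑ j, Fb i j x * ∑ l, Nup h u l x * pd l (h i j) x := by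
      rw [phiHat, ← mul_assoc, mul_one_div_cancel (by positivity), one_mul, e₁]
      simp_rw [e₂]
      rw [Finset.mul_sum (a := nr h u x), Finset.mul_sum (a := 1 / 2 * nr h u x),
        ← Finset.sum_neg_distrib, ← Finset.sum_add_distrib, ← Finset.sum_add_distrib]
      refine Finset.sum_congr rfl fun i _ => ?_
      rw [Finset.mul_sum (a := nr h u x), Finset.mul_sum (a := 1 / 2 * nr h u x),
        ← Finset.sum_neg_distrib, ← Finset.sum_add_distrib, ← Finset.sum_add_distrib]
      exact Finset.sum_congr rfl fun j _ => by ring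
    refine mul_left_cancel₀ npos.ne' ?_
    rw [hQN]
    linear_combination e₃ - e₀
  have hGN : ∑ k, Nup h u k x * Gc g h k₀ Fb u k x
      = 2 * phiHat h k₀ Fb u x
        - QL h k₀ Fb u (Dlow g h) x / (2 * (nr h u x) ^ 2) := by
    have e : ∀ k, Nup h u k x * Gc g h k₀ Fb u k x
        = (2 * phiHat h k₀ Fb u x - QL h k₀ Fb u (Dlow g h) x / (2 * (nr h u x) ^ 2)
            - QN h k₀ Fb u (Dlow g h) x / nr h u x) * (Nup h u k x * Nlow h u k x)
          + (Nup h u k x * Qc h k₀ Fb u (Dlow g h) k x) / nr h u x := fun k => by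
      rw [Gc]
      ring
    simp_rw [e, Finset.sum_add_distrib]
    rw [← Finset.mul_sum, hNN, ← Finset.sum_div, ← QN]
    ring
  set XN := ∑ k, Nup h u k x * Xhat g h k₀ Fb u k x with hXN
  set Y : Fin 3 → ℝ := fun j =>
    -(Xhat g h k₀ Fb u j x / nr h u x) + nr h u x / 2 * Gc g h k₀ Fb u j x with hY
  have hYN : ∑ k, Nup h u k x * Y k
      = -(XN / nr h u x)
        + nr h u x / 2 * ∑ k, Nup h u k x * Gc g h k₀ Fb u k x := by
    rw [hXN, Finset.sum_div, Finset.mul_sum, ← Finset.sum_neg_distrib,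
      ← Finset.sum_add_distrib]
    exact Finset.sum_congr rfl fun k _ => by rw [hY]; ring
  have hκ : ∀ i j, kap17 g h k₀ Fb T u i j x
      = Nlow h u i x * Y j + Nlow h u j x * Y i
        + (XN / (2 * nr h u x) - 2 * nr h u x * phiHat h k₀ Fb u x) * g i j x
        + (-1 / 2) * T i j x := fun i j => by
    rw [kap17, tensf, hgN, hgN, ← hXN, hY]
    field_simp
    ring
  have hP : ∀ i j, P2f g h (Nup h u) (kap17 g h k₀ Fb T u) i j x
      = kap17 g h k₀ Fb T u i j x := by
    refine P2f_eq_self (by simp_rw [hgN]; exact hNN) fun j => ?_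
    simp_rw [hκ]
    rw [hgN, trace_decomposition hs (h_inv₁ x hx) (hg_symm x hx) hN,
      contraction_decomposition (g := fun a b => g a b x) (N := fun a => Nup h u a x)
        (Nl := fun a => Nlow h u a x) (hg_symm x hx) hgN hNN Y _ _ (fun a b => T a b x), hT_tr x hx, hTN, ← Q0, hYN, hGN]
    simp only [hY]
    rw [hX, Gc]
    field_simp
    linear_combination 2 * nr h u x * Nlow h u j x * hφ
  refine ⟨fun i j => ?_, hP⟩
  rw [hP, kap17, hω, hω]
  ring
end
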